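/- Let Ω = (0,1)² ⊂ ℝ², let Y be a normed space, let K : L²(Ω) → Y be a bounded linear operator that does not vanish on constant functions (K(𝟙_Ω) ≠ 0), and let g ∈ Y. If {f_n} ⊂ L²(Ω) is a bounded sequence and {z_n} ⊂ L²(Ω) satisfies ‖z_n‖_{L²(Ω)} → ∞, then (1/2)‖K(f_n + z_n) − g‖_Y² + TV(z_n) → ∞. -/

import Mathlib

open MeasureTheory Set Filter Topology
open scoped ENNReal NNReal

noncomputable section

/-- Euclidean space `ℝ^d`. -/
abbrev Euc (d : ℕ) := EuclideanSpace ℝ (Fin d)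

/-- The divergence `div ψ = ∑ i ∂ᵢ ψᵢ` of a vector field `ψ : ℝ^d → ℝ^d`. -/
noncomputable def divg (d : ℕ) (ψ : Euc d → Euc d) (x : Euc d) : ℝ :=
  ∑ i : Fin d, fderiv ℝ ψ x (EuclideanSpace.single i (1:ℝ)) i

/-- The total variation
`TV(f) = sup { −∫_Ω f div ψ dx : ψ ∈ C_c¹(Ω, ℝ^d), ‖ψ‖_∞ ≤ 1 }`, valued in `ℝ≥0∞`
(it equals `+∞` when the supremum is infinite). -/
noncomputable def TVar (d : ℕ) (Ω : Set (Euc d)) (f : Euc d → ℝ) : ℝ≥0∞ :=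
  ⨆ (ψ : Euc d → Euc d) (_ : ContDiff ℝ 1 ψ) (_ : HasCompactSupport ψ)
    (_ : tsupport ψ ⊆ Ω) (_ : ∀ x, ‖ψ x‖ ≤ 1),
    ENNReal.ofReal (-∫ x in Ω, f x * divg d ψ x)

/-- The open unit square `Ω = (0,1)² ⊂ ℝ²`. -/
def unitSq : Set (Euc 2) := {x : Euc 2 | x 0 ∈ Ioo (0:ℝ) 1 ∧ x 1 ∈ Ioo (0:ℝ) 1}

open Convolution

lemma fderiv_apply_neg_of_even {E : Type*} [NormedAddCommGroup E] [NormedSpace ℝ E]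
    {r : E → ℝ} (hr : ∀ x, r (-x) = r x) (x v : E) :
    fderiv ℝ r (-x) v = -fderiv ℝ r x v := by
  have h := fderiv_comp_smul (f := r) (x := x) (-1 : ℝ)
  simp only [neg_smul, one_smul, hr] at h
  simp [h]

section Mollification

variable {E : Type*} [NormedAddCommGroup E] [InnerProductSpace ℝ E] [FiniteDimensional ℝ E]
  [MeasurableSpace E] [BorelSpace E]

lemma fderiv_convolution_left_apply {r F : E → ℝ} (hr : ContDiff ℝ 1 r)
    (hrc : HasCompactSupport r) (hF : LocallyIntegrable F volume) (x v : E) :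
    fderiv ℝ (r ⋆ F) x v = ∫ t, fderiv ℝ r (x - t) v * F t := by
  rw [(hrc.hasFDerivAt_convolution_left (ContinuousLinearMap.lsmul ℝ ℝ) hr hF x).fderiv,
    convolution_eq_swap, ContinuousLinearMap.integral_apply]
  · rfl
  · exact (hrc.fderiv ℝ).convolutionExists_left _ (hr.continuous_fderiv one_ne_zero) hF x
      |>.integrable_swap

/-- Convolution with an even kernel is formally self-adjoint, so its derivative is formally
skew-adjoint. -/
lemma integral_mul_fderiv_convolution_left {r F φ : E → ℝ} (hr : ContDiff ℝ 1 r)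
    (hrc : HasCompactSupport r) (hreven : ∀ x, r (-x) = r x)
    (hF : Integrable F) (hφ : Integrable φ) (v : E) :
    ∫ x, φ x * fderiv ℝ (r ⋆ F) x v = -∫ t, F t * fderiv ℝ (r ⋆ φ) t v := by
  have hcont : Continuous fun w => fderiv ℝ r w v :=
    (hr.continuous_fderiv one_ne_zero).clm_apply continuous_const
  obtain ⟨C, hC⟩ := hcont.bounded_above_of_compact_support (hrc.fderiv_apply ℝ v)
  simp_rw [fderiv_convolution_left_apply hr hrc hF.locallyIntegrable,
    fderiv_convolution_left_apply hr hrc hφ.locallyIntegrable, ← integral_const_mul]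
  rw [integral_integral_swap, ← integral_neg]
  · congr 1 with t
    rw [← integral_neg]
    congr 1 with x
    rw [← neg_sub t x, fderiv_apply_neg_of_even hreven]
    ring
  · have := (hφ.mul_prod hF).bdd_mul (f := fun z : E × E => fderiv ℝ r (z.1 - z.2) v) (c := C)
      (hcont.comp (continuous_fst.sub continuous_snd)).aestronglyMeasurable
      (ae_of_all _ fun z => hC _)
    refine this.congr (ae_of_all _ fun z => ?_)
    simp only [Function.uncurry]
    ring

end Mollification

lemma divg_smul_single {d : ℕ} {w : Euc d → ℝ} (hw : Differentiable ℝ w) (i : Fin d)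
    (x : Euc d) :
    divg d (fun y => w y • EuclideanSpace.single i (1 : ℝ)) x
      = fderiv ℝ w x (EuclideanSpace.single i 1) := by
  simp only [divg, fderiv_smul_const (hw x), ContinuousLinearMap.smulRight_apply,
    PiLp.smul_apply, PiLp.single_apply, smul_eq_mul, mul_ite, mul_one, mul_zero,
    Finset.sum_ite_eq', Finset.mem_univ, if_true]

lemma ofReal_neg_integral_mul_fderiv_le_TVar {d : ℕ} {Ω : Set (Euc d)} {f w : Euc d → ℝ}
    (hw : ContDiff ℝ 1 w) (hwc : HasCompactSupport w) (hwΩ : tsupport w ⊆ Ω)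
    (hw1 : ∀ x, |w x| ≤ 1) (i : Fin d) :
    ENNReal.ofReal (-∫ x in Ω, f x * fderiv ℝ w x (EuclideanSpace.single i 1))
      ≤ TVar d Ω f := by
  simp_rw [← divg_smul_single (hw.differentiable one_ne_zero)]
  unfold TVar
  refine le_iSup_of_le (fun y => w y • EuclideanSpace.single i (1 : ℝ)) ?_
  refine le_iSup_of_le (hw.smul contDiff_const) ?_
  refine le_iSup_of_le (hwc.smul_right (f' := fun _ => EuclideanSpace.single i (1 : ℝ))) ?_
  refine le_iSup_of_le ((closure_mono (Function.support_smul_subset_left w _)).trans hwΩ) ?_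
  refine le_iSup_of_le (fun x => ?_) le_rfl
  simpa [norm_smul] using hw1 x

/-- The total variation controls the partial derivatives of mollifications on sets well inside
the domain. -/
lemma lintegral_fderiv_mollify_le_TVar {d : ℕ} {Ω S : Set (Euc d)} (hΩ : MeasurableSet Ω)
    (hS : IsCompact S) {f : Euc d → ℝ} (hf : IntegrableOn f Ω) (ρ : ContDiffBump (0 : Euc d))
    (hSΩ : Metric.cthickening ρ.rOut S ⊆ Ω) (i : Fin d) :
    ∫⁻ x in S, ‖fderiv ℝ (ρ.normed volume ⋆ Ω.indicator f) x (EuclideanSpace.single i 1)‖ₑ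
      ≤ TVar d Ω f := by
  set r := ρ.normed volume with hr_def
  set F := Ω.indicator f with hF_def
  set v : Euc d := EuclideanSpace.single i 1
  have hr : ContDiff ℝ 1 r := ρ.contDiff_normed
  have hrc : HasCompactSupport r := ρ.hasCompactSupport_normed
  have hF : Integrable F := hf.integrable_indicator hΩ
  have hcont : Continuous fun x => fderiv ℝ (r ⋆ F) x v :=
    ((hrc.contDiff_convolution_left _ hr hF.locallyIntegrable).continuous_fderiv
      one_ne_zero).clm_apply continuous_const
  set φ : Euc d → ℝ := S.indicator fun x => SignType.sign (fderiv ℝ (r ⋆ F) x v) with hφ_def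
  have hφ1 : ∀ x, |φ x| ≤ 1 := by
    intro x
    by_cases hx : x ∈ S
    · rw [hφ_def, indicator_of_mem hx]
      rcases lt_trichotomy (fderiv ℝ (r ⋆ F) x v) 0 with h | h | h <;> simp [h]
    · simp [hφ_def, hx]
  have hφm : Measurable φ := by
    refine Measurable.indicator ?_ hS.measurableSet
    have h : (fun x => ((SignType.sign (fderiv ℝ (r ⋆ F) x v) : SignType) : ℝ)) = fun x =>
        if 0 < fderiv ℝ (r ⋆ F) x v then 1 else if fderiv ℝ (r ⋆ F) x v < 0 then -1 else 0 := by
      ext x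
      rw [sign_apply]
      split_ifs <;> simp
    rw [h]
    exact Measurable.ite (measurableSet_lt measurable_const hcont.measurable) measurable_const
      (Measurable.ite (measurableSet_lt hcont.measurable measurable_const) measurable_const
        measurable_const)
  have hφ : Integrable φ := by
    refine ((integrable_indicator_iff hS.measurableSet).2
      (integrableOn_const (C := (1 : ℝ)) hS.measure_lt_top.ne)).mono'
      hφm.aestronglyMeasurable (ae_of_all _ fun x => ?_)
    by_cases hx : x ∈ S
    · simpa [hx] using hφ1 x
    · simp [hφ_def, hx]
  set w := r ⋆ φ with hw_def
  have hsupp : Function.support w ⊆ Metric.thickening ρ.rOut S := by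
    refine (support_convolution_subset _).trans ?_
    rintro _ ⟨a, ha, b, hb, rfl⟩
    rw [hr_def, ρ.support_normed_eq] at ha
    refine Metric.mem_thickening_iff.2 ⟨b, ?_, by simpa using ha⟩
    by_contra h
    exact hb (by simp [hφ_def, h])
  have htsupp : tsupport w ⊆ Metric.cthickening ρ.rOut S :=
    (closure_mono hsupp).trans (Metric.closure_thickening_subset_cthickening _ _)
  have hw1 : ∀ x, |w x| ≤ 1 := by
    intro x
    have := dist_convolution_le (z₀ := (0 : ℝ)) (f := r) (μ := volume) (g := φ) (x₀ := x)
      zero_le_one ρ.support_normed_eq.subset ρ.nonneg_normed ρ.integral_normed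
      hφ.aestronglyMeasurable (fun y _ => by simpa using hφ1 y)
    simpa using this
  have hreven : ∀ x, r (-x) = r x := fun x => ρ.normed_neg x
  calc ∫⁻ x in S, ‖fderiv ℝ (r ⋆ F) x v‖ₑ
      = ENNReal.ofReal (∫ x in S, ‖fderiv ℝ (r ⋆ F) x v‖) :=
        (ofReal_integral_norm_eq_lintegral_enorm
          (hcont.continuousOn.integrableOn_compact hS)).symm
    _ = ENNReal.ofReal (∫ x, φ x * fderiv ℝ (r ⋆ F) x v) := by
        rw [← integral_indicator hS.measurableSet]
        congr 2 with x
        by_cases hx : x ∈ S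
        · simp only [hφ_def, indicator_of_mem hx, Real.norm_eq_abs]
          exact (sign_mul_self _).symm
        · simp [hφ_def, hx]
    _ = ENNReal.ofReal (-∫ x in Ω, f x * fderiv ℝ w x v) := by
        rw [integral_mul_fderiv_convolution_left hr hrc hreven hF hφ, ← integral_indicator hΩ]
        congr 3 with x
        by_cases hx : x ∈ Ω <;> simp [hF_def, hx, hw_def]
    _ ≤ TVar d Ω f :=
        ofReal_neg_integral_mul_fderiv_le_TVar
          (hrc.contDiff_convolution_left _ hr hφ.locallyIntegrable)
          (hS.cthickening.of_isClosed_subset (isClosed_tsupport _) htsupp)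
          (htsupp.trans hSΩ) hw1 i

lemma lintegral_lintegral_add_mul_add_le {X : Type*} [MeasurableSpace X] (ν : Measure X)
    (hν : ν univ ≤ 1) {α β : X → ℝ≥0∞} (hα : Measurable α) (hβ : Measurable β) {a b : ℝ≥0∞}
    (ha : ∫⁻ p, α p ∂ν ≤ a) (hb : ∫⁻ p, β p ∂ν ≤ b) (hab : ∫⁻ p, α p * β p ∂ν ≤ a * b) :
    ∫⁻ p, ∫⁻ q, (α p + β q) * (β p + α q) ∂ν ∂ν ≤ (a + b) ^ 2 := by
  have hconst : ∀ c : ℝ≥0∞, ∫⁻ _, c ∂ν ≤ c := fun c => by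
    rw [lintegral_const]; exact mul_le_of_le_one_right' hν
  have inner : ∀ p, ∫⁻ q, (α p + β q) * (β p + α q) ∂ν
      ≤ α p * β p + α p * a + β p * b + a * b := by
    intro p
    calc ∫⁻ q, (α p + β q) * (β p + α q) ∂ν
        = ∫⁻ q, (α p * β p + α p * α q + β p * β q + α q * β q) ∂ν := by
          congr 1 with q; ring
      _ = ∫⁻ _, α p * β p ∂ν + α p * ∫⁻ q, α q ∂ν + β p * ∫⁻ q, β q ∂ν
            + ∫⁻ q, α q * β q ∂ν := by
          rw [lintegral_add_right _ (by fun_prop), lintegral_add_right _ (hβ.const_mul _),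
            lintegral_add_right _ (hα.const_mul _), lintegral_const_mul _ hα,
            lintegral_const_mul _ hβ]
      _ ≤ _ := by gcongr; exact hconst _
  calc ∫⁻ p, ∫⁻ q, (α p + β q) * (β p + α q) ∂ν ∂ν
      ≤ ∫⁻ p, (α p * β p + α p * a + β p * b + a * b) ∂ν := lintegral_mono inner
    _ = ∫⁻ p, α p * β p ∂ν + (∫⁻ p, α p ∂ν) * a + (∫⁻ p, β p ∂ν) * b + ∫⁻ _, a * b ∂ν := by
        rw [lintegral_add_right _ measurable_const, lintegral_add_right _ (hβ.mul_const _),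
          lintegral_add_right _ (hα.mul_const _), lintegral_mul_const _ hα,
          lintegral_mul_const _ hβ]
    _ ≤ a * b + a * a + b * b + a * b := by gcongr; exact hconst _
    _ = (a + b) ^ 2 := by ring

/-- The closed coordinate square `I × I` in the Euclidean plane. -/
def coordSq (I : Set ℝ) : Set (Euc 2) := {p | p 0 ∈ I ∧ p 1 ∈ I}

lemma measurePreserving_toEuc2 :
    MeasurePreserving (fun z : ℝ × ℝ => (!₂[z.1, z.2] : Euc 2)) := by
  have h := (PiLp.volume_preserving_toLp (Fin 2)).comp (volume_preserving_finTwoArrow ℝ).symm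
  exact h

lemma measurableSet_coordSq {I : Set ℝ} (hI : MeasurableSet I) : MeasurableSet (coordSq I) :=
  ((by fun_prop : Measurable fun p : Euc 2 => p 0) hI).inter
    ((by fun_prop : Measurable fun p : Euc 2 => p 1) hI)

lemma setLIntegral_coordSq {I : Set ℝ} (hI : MeasurableSet I) {h : Euc 2 → ℝ≥0∞}
    (hh : Measurable h) :
    ∫⁻ p in coordSq I, h p = ∫⁻ x in I, ∫⁻ y in I, h !₂[x, y] := by
  have hm := measurePreserving_toEuc2
  have hpre : (fun z : ℝ × ℝ => (!₂[z.1, z.2] : Euc 2)) ⁻¹' coordSq I = I ×ˢ I := by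
    ext z; simp [coordSq]
  rw [← (hm.restrict_preimage (measurableSet_coordSq hI)).lintegral_comp hh, hpre,
    Measure.volume_eq_prod, ← Measure.prod_restrict,
    lintegral_prod (fun z : ℝ × ℝ => h !₂[z.1, z.2]) (hh.comp hm.measurable).aemeasurable]

lemma volume_coordSq {I : Set ℝ} (hI : MeasurableSet I) :
    volume (coordSq I) = volume I * volume I := by
  have := setLIntegral_coordSq hI (h := fun _ => 1) measurable_const
  simpa using this

/-- A function varies along a segment by at most the integral of its derivative. -/
lemma enorm_sub_le_lintegral_fderiv {E : Type*} [NormedAddCommGroup E] [NormedSpace ℝ E]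
    {u : E → ℝ} (hu : ContDiff ℝ 1 u) {γ : ℝ → E} {v : E} (hγ : ∀ t, HasDerivAt γ v t)
    {a b s t : ℝ} (hs : s ∈ Icc a b) (ht : t ∈ Icc a b) :
    ‖u (γ s) - u (γ t)‖ₑ ≤ ∫⁻ x in Icc a b, ‖fderiv ℝ u (γ x) v‖ₑ := by
  wlog hst : t ≤ s generalizing s t
  · rw [← enorm_neg, neg_sub]
    exact this ht hs (le_of_not_ge hst)
  have hd : ∀ x, HasDerivAt (u ∘ γ) (fderiv ℝ u (γ x) v) x := fun x =>
    (hu.differentiable one_ne_zero (γ x)).hasFDerivAt.comp_hasDerivAt x (hγ x)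
  have hγc : Continuous γ := continuous_iff_continuousAt.2 fun x => (hγ x).continuousAt
  have hderiv : deriv (u ∘ γ) = fun x => fderiv ℝ u (γ x) v := funext fun x => (hd x).deriv
  have hcd : ContDiff ℝ 1 (u ∘ γ) := by
    rw [contDiff_one_iff_deriv, hderiv]
    exact ⟨fun x => (hd x).differentiableAt,
      ((hu.continuous_fderiv one_ne_zero).comp hγc).clm_apply continuous_const⟩
  calc ‖u (γ s) - u (γ t)‖ₑ ≤ ∫⁻ x in Icc t s, ‖deriv (u ∘ γ) x‖ₑ :=
        enorm_sub_le_lintegral_deriv_of_contDiffOn_Icc hcd.contDiffOn hst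
    _ ≤ ∫⁻ x in Icc a b, ‖deriv (u ∘ γ) x‖ₑ := lintegral_mono_set (Icc_subset_Icc ht.1 hs.2)
    _ = _ := by rw [hderiv]

/-- A Poincaré inequality with the critical exponent on a coordinate square of side at most one,
for continuously differentiable functions. -/
lemma lintegral_enorm_sub_sq_le_of_contDiff {u : Euc 2 → ℝ} (hu : ContDiff ℝ 1 u) {a b : ℝ}
    (hab : b - a ≤ 1) :
    ∫⁻ p in coordSq (Icc a b), ∫⁻ q in coordSq (Icc a b), ‖u p - u q‖ₑ ^ 2
      ≤ ((∫⁻ p in coordSq (Icc a b), ‖fderiv ℝ u p (EuclideanSpace.single 0 1)‖ₑ)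
        + ∫⁻ p in coordSq (Icc a b), ‖fderiv ℝ u p (EuclideanSpace.single 1 1)‖ₑ) ^ 2 := by
  set I := Icc a b
  have hI : MeasurableSet I := measurableSet_Icc
  have hI1 : volume I ≤ 1 := by
    rw [Real.volume_Icc]; exact ENNReal.ofReal_le_one.2 hab
  have hmeas : ∀ v : Euc 2, Measurable fun p => ‖fderiv ℝ u p v‖ₑ := fun v =>
    ((hu.continuous_fderiv one_ne_zero).clm_apply continuous_const).measurable.enorm
  set A : ℝ → ℝ≥0∞ := fun y =>
    ∫⁻ x in I, ‖fderiv ℝ u !₂[x, y] (EuclideanSpace.single 0 1)‖ₑ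
  set B : ℝ → ℝ≥0∞ := fun x =>
    ∫⁻ y in I, ‖fderiv ℝ u !₂[x, y] (EuclideanSpace.single 1 1)‖ₑ
  have hm := measurePreserving_toEuc2.measurable
  have hA : Measurable A := Measurable.lintegral_prod_left' ((hmeas _).comp hm)
  have hB : Measurable B := Measurable.lintegral_prod_right' ((hmeas _).comp hm)
  have hAint : ∫⁻ y in I, A y
      = ∫⁻ p in coordSq I, ‖fderiv ℝ u p (EuclideanSpace.single 0 1)‖ₑ := by
    rw [setLIntegral_coordSq hI (hmeas _)]
    exact lintegral_lintegral_swap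
      (((hmeas (EuclideanSpace.single 0 1)).comp hm).comp measurable_swap).aemeasurable
  have hBint : ∫⁻ x in I, B x
      = ∫⁻ p in coordSq I, ‖fderiv ℝ u p (EuclideanSpace.single 1 1)‖ₑ := by
    rw [setLIntegral_coordSq hI (hmeas _)]
  have hα : Measurable fun p : Euc 2 => A (p 1) := hA.comp (by fun_prop)
  have hβ : Measurable fun p : Euc 2 => B (p 0) := hB.comp (by fun_prop)
  rw [← hAint, ← hBint]
  have hx : ∀ y, ∀ s ∈ I, ∀ t ∈ I, ‖u !₂[s, y] - u !₂[t, y]‖ₑ ≤ A y := by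
    intro y s hs t ht
    refine enorm_sub_le_lintegral_fderiv hu (γ := fun x => !₂[x, y]) (fun x => ?_) hs ht
    have h : (fun x : ℝ => (!₂[x, y] : Euc 2))
        = fun x => !₂[0, y] + x • EuclideanSpace.single 0 1 := by
      ext x i; fin_cases i <;> simp
    rw [h]
    simpa using ((hasDerivAt_id x).smul_const (EuclideanSpace.single (0 : Fin 2) (1 : ℝ))).const_add
      (!₂[0, y] : Euc 2)
  have hy : ∀ x, ∀ s ∈ I, ∀ t ∈ I, ‖u !₂[x, s] - u !₂[x, t]‖ₑ ≤ B x := by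
    intro x s hs t ht
    refine enorm_sub_le_lintegral_fderiv hu (γ := fun y => !₂[x, y]) (fun y => ?_) hs ht
    have h : (fun y : ℝ => (!₂[x, y] : Euc 2))
        = fun y => !₂[x, 0] + y • EuclideanSpace.single 1 1 := by
      ext y i; fin_cases i <;> simp
    rw [h]
    simpa using ((hasDerivAt_id y).smul_const (EuclideanSpace.single (1 : Fin 2) (1 : ℝ))).const_add
      (!₂[x, 0] : Euc 2)
  have heta : ∀ p : Euc 2, !₂[p 0, p 1] = p := fun p => by
    ext i; fin_cases i <;> rfl
  calc ∫⁻ p in coordSq I, ∫⁻ q in coordSq I, ‖u p - u q‖ₑ ^ 2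
      ≤ ∫⁻ p in coordSq I, ∫⁻ q in coordSq I, (A (p 1) + B (q 0)) * (B (p 0) + A (q 1)) := by
        refine setLIntegral_mono' (measurableSet_coordSq hI) fun p hp => ?_
        refine setLIntegral_mono' (measurableSet_coordSq hI) fun q hq => ?_
        rw [sq]
        gcongr
        · calc ‖u p - u q‖ₑ
              = ‖(u !₂[p 0, p 1] - u !₂[q 0, p 1]) + (u !₂[q 0, p 1] - u !₂[q 0, q 1])‖ₑ := by
                rw [heta, heta, sub_add_sub_cancel]
            _ ≤ _ := (enorm_add_le _ _).trans
                (add_le_add (hx _ _ hp.1 _ hq.1) (hy _ _ hp.2 _ hq.2))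
        · calc ‖u p - u q‖ₑ
              = ‖(u !₂[p 0, p 1] - u !₂[p 0, q 1]) + (u !₂[p 0, q 1] - u !₂[q 0, q 1])‖ₑ := by
                rw [heta, heta, sub_add_sub_cancel]
            _ ≤ _ := (enorm_add_le _ _).trans
                (add_le_add (hy _ _ hp.2 _ hq.2) (hx _ _ hp.1 _ hq.1))
    _ ≤ _ := by
        refine lintegral_lintegral_add_mul_add_le _ ?_ hα hβ ?_ ?_ ?_
        · rw [Measure.restrict_apply_univ, volume_coordSq hI]
          exact mul_le_one' hI1 hI1
        · rw [setLIntegral_coordSq hI hα]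
          simpa using mul_le_of_le_one_right' hI1
        · rw [setLIntegral_coordSq hI hβ]
          simp only [Matrix.cons_val_zero, lintegral_const,
            Measure.restrict_apply_univ]
          rw [lintegral_mul_const _ hB]
          exact mul_le_of_le_one_right' hI1
        · rw [setLIntegral_coordSq hI (h := fun p => A (p 1) * B (p 0)) (hα.mul hβ)]
          simp only [Matrix.cons_val_zero, Matrix.cons_val_one]
          simp_rw [lintegral_mul_const _ hA]
          rw [lintegral_const_mul _ hB]

lemma isCompact_coordSq {I : Set ℝ} (hI : IsCompact I) : IsCompact (coordSq I) := by
  have h : coordSq I = (fun z : ℝ × ℝ => (!₂[z.1, z.2] : Euc 2)) '' (I ×ˢ I) := by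
    ext p
    refine ⟨fun hp => ⟨(p 0, p 1), hp, ?_⟩, ?_⟩
    · ext i; fin_cases i <;> rfl
    · rintro ⟨z, hz, rfl⟩
      exact hz
  rw [h]
  exact (hI.prod hI).image (by fun_prop)

lemma cthickening_coordSq_subset_unitSq {δ r : ℝ} (hr : 0 ≤ r) (hrδ : r < δ) :
    Metric.cthickening r (coordSq (Icc δ (1 - δ))) ⊆ unitSq := by
  rw [(isCompact_coordSq isCompact_Icc).cthickening_eq_biUnion_closedBall hr]
  refine iUnion₂_subset fun s hs z hz => ?_
  have h : ∀ i, |z i - s i| ≤ r := fun i => by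
    have := PiLp.norm_apply_le (z - s) i
    rw [← dist_eq_norm] at this
    exact this.trans hz
  obtain ⟨⟨h1, h2⟩, h3, h4⟩ := hs
  have h0 := abs_le.1 (h 0)
  have h1' := abs_le.1 (h 1)
  exact ⟨⟨by linarith, by linarith⟩, by linarith, by linarith⟩

lemma measurableSet_unitSq : MeasurableSet unitSq := measurableSet_coordSq measurableSet_Ioo

lemma volume_unitSq : volume unitSq = 1 := by
  refine (volume_coordSq (I := Ioo 0 1) measurableSet_Ioo).trans ?_
  simp

/-- A Poincaré–Wirtinger inequality with the critical exponent on the unit square, in terms of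
the total variation. -/
lemma lintegral_enorm_sub_sq_le_TVar {f : Euc 2 → ℝ} (hf : IntegrableOn f unitSq) :
    ∫⁻ z, ‖f z.1 - f z.2‖ₑ ^ 2 ∂((volume.restrict unitSq).prod (volume.restrict unitSq))
      ≤ (2 * TVar 2 unitSq f) ^ 2 := by
  set ν := volume.restrict unitSq with hν
  set δ : ℕ → ℝ := fun k => 1 / ((k : ℝ) + 1)
  have hδ : ∀ k, 0 < δ k := fun k => Nat.one_div_pos_of_nat
  have hδ0 : Tendsto δ atTop (𝓝 0) := tendsto_one_div_add_atTop_nhds_zero_nat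
  let ρ : ℕ → ContDiffBump (0 : Euc 2) := fun k =>
    ⟨δ k / 4, δ k / 2, by linarith [hδ k], by linarith [hδ k]⟩
  set S : ℕ → Set (Euc 2) := fun k => coordSq (Icc (δ k) (1 - δ k))
  have hSm : ∀ k, MeasurableSet (S k) := fun k => measurableSet_coordSq measurableSet_Icc
  set F := unitSq.indicator f
  have hF : Integrable F := hf.integrable_indicator measurableSet_unitSq
  set u : ℕ → Euc 2 → ℝ := fun k => (ρ k).normed volume ⋆ F
  have hu : ∀ k, ContDiff ℝ 1 (u k) := fun k =>
    (ρ k).hasCompactSupport_normed.contDiff_convolution_left _ (ρ k).contDiff_normed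
      hF.locallyIntegrable
  have hbound : ∀ k, ∫⁻ p in S k, ∫⁻ q in S k, ‖u k p - u k q‖ₑ ^ 2
      ≤ (2 * TVar 2 unitSq f) ^ 2 := by
    intro k
    refine (lintegral_enorm_sub_sq_le_of_contDiff (hu k) (by linarith [hδ k])).trans ?_
    rw [two_mul]
    have h := lintegral_fderiv_mollify_le_TVar measurableSet_unitSq
      (isCompact_coordSq (isCompact_Icc (a := δ k) (b := 1 - δ k))) hf (ρ k)
      (cthickening_coordSq_subset_unitSq (ρ k).rOut_pos.le (half_lt_self (hδ k)))
    gcongr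
    · exact h 0
    · exact h 1
  have hlim : ∀ᵐ p ∂ν, Tendsto (fun k => u k p) atTop (𝓝 (f p)) ∧ ∀ᶠ k in atTop, p ∈ S k := by
    have hae := ContDiffBump.ae_convolution_tendsto_right_of_locallyIntegrable (φ := ρ)
      (l := atTop) (K := 2) (by simpa using hδ0.div_const 2)
      (Eventually.of_forall fun k => by change δ k / 2 ≤ 2 * (δ k / 4); linarith)
      hF.locallyIntegrable
    filter_upwards [ae_restrict_of_ae hae, ae_restrict_mem measurableSet_unitSq] with p hp hpΩ
    refine ⟨by simpa [F, hpΩ] using hp, ?_⟩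
    obtain ⟨⟨h1, h2⟩, h3, h4⟩ := hpΩ
    filter_upwards [hδ0.eventually_lt_const h1, hδ0.eventually_lt_const h3,
      hδ0.eventually_lt_const (sub_pos.2 h2), hδ0.eventually_lt_const (sub_pos.2 h4)]
      with k a1 a2 a3 a4
    exact ⟨⟨a1.le, by linarith⟩, a2.le, by linarith⟩
  set G : ℕ → Euc 2 × Euc 2 → ℝ≥0∞ := fun k z => ‖u k z.1 - u k z.2‖ₑ ^ 2
  have hG : ∀ k, Measurable (G k) := fun k => by
    have := (hu k).continuous.measurable
    fun_prop
  have hlim' : ∀ᵐ z ∂(ν.prod ν), ‖f z.1 - f z.2‖ₑ ^ 2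
      = liminf (fun k => (S k ×ˢ S k).indicator (G k) z) atTop := by
    filter_upwards [Measure.quasiMeasurePreserving_fst.ae hlim,
      Measure.quasiMeasurePreserving_snd.ae hlim] with z h1 h2
    symm
    refine Tendsto.liminf_eq ?_
    have : Tendsto (fun k => G k z) atTop (𝓝 (‖f z.1 - f z.2‖ₑ ^ 2)) :=
      ((ENNReal.continuous_pow 2).tendsto _).comp (h1.1.sub h2.1).enorm
    refine this.congr' ?_
    filter_upwards [h1.2, h2.2] with k a1 a2
    rw [indicator_of_mem (mk_mem_prod a1 a2)]
  rw [lintegral_congr_ae hlim']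
  refine (lintegral_liminf_le fun k => (hG k).indicator ((hSm k).prod (hSm k))).trans ?_
  refine liminf_le_of_le (by isBoundedDefault) fun c hc => ?_
  obtain ⟨k, hk⟩ := hc.exists
  refine hk.trans ((le_trans ?_ (hbound k)))
  rw [lintegral_indicator ((hSm k).prod (hSm k)), ← Measure.prod_restrict,
    lintegral_prod _ (hG k).aemeasurable, hν]
  refine lintegral_mono' (Measure.restrict_mono_measure Measure.restrict_le_self _) fun p => ?_
  exact lintegral_mono' (Measure.restrict_mono_measure Measure.restrict_le_self _) le_rfl

instance : IsProbabilityMeasure (volume.restrict unitSq) :=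
  ⟨by rw [Measure.restrict_apply_univ, volume_unitSq]⟩

/-- Every square-integrable function on the unit square is within twice its total variation of
some constant, in the `L²` norm. -/
lemma exists_const_eLpNorm_sub_le_TVar (z : Lp ℝ 2 (volume.restrict unitSq)) :
    ∃ c : ℝ, eLpNorm (fun p => z p - c) 2 (volume.restrict unitSq) ≤ 2 * TVar 2 unitSq z := by
  have hzm : AEStronglyMeasurable z (volume.restrict unitSq) := (Lp.memLp z).1
  have hzint : IntegrableOn z unitSq := (Lp.memLp z).integrable one_le_two
  have hm : AEMeasurable (fun w : Euc 2 × Euc 2 => ‖z w.1 - z w.2‖ₑ ^ 2)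
      ((volume.restrict unitSq).prod (volume.restrict unitSq)) :=
    ((hzm.comp_fst.sub hzm.comp_snd).enorm).pow_const 2
  have hle := lintegral_enorm_sub_sq_le_TVar hzint
  rw [lintegral_prod_symm _ hm] at hle
  obtain ⟨q, hq⟩ := exists_le_lintegral (μ := volume.restrict unitSq) hm.lintegral_prod_left'
  refine ⟨z q, ?_⟩
  have h := hq.trans hle
  rw [eLpNorm_eq_lintegral_rpow_enorm_toReal two_ne_zero ENNReal.ofNat_ne_top]
  simp only [ENNReal.toReal_ofNat, ENNReal.rpow_ofNat]
  rwa [one_div, ENNReal.rpow_inv_le_iff two_pos, ENNReal.rpow_ofNat]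

/-- **Coercivity of the data term plus TV in the source variable** (Condition (5) for the
specific setting). Let `Ω = (0,1)²`, let `K : L²(Ω) → Y` be a bounded linear operator with
`K(𝟙_Ω) ≠ 0`, and `g ∈ Y`. If `{fₙ}` is bounded in `L²(Ω)` and `‖zₙ‖_{L²} → ∞`, then
`½‖K(fₙ + zₙ) − g‖² + TV(zₙ) → ∞`. -/
theorem data_term_plus_tv_coercive
    (Y : Type*) [NormedAddCommGroup Y] [NormedSpace ℝ Y]
    (K : Lp ℝ 2 (volume.restrict unitSq) →L[ℝ] Y)
    -- `K` does not vanish on constant functions: `K 𝟙_Ω ≠ 0`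
    (hK1 : ∀ u : Lp ℝ 2 (volume.restrict unitSq),
      (⇑u =ᵐ[volume.restrict unitSq] fun _ => (1:ℝ)) → K u ≠ 0)
    (g : Y)
    (fn : ℕ → Lp ℝ 2 (volume.restrict unitSq))
    (zn : ℕ → Lp ℝ 2 (volume.restrict unitSq))
    (hfb : ∃ M : ℝ, ∀ n, ‖fn n‖ ≤ M)
    (hz : Tendsto (fun n => ‖zn n‖) atTop atTop) :
    Tendsto (fun n =>
        ENNReal.ofReal (2⁻¹ * ‖K (fn n + zn n) - g‖ ^ 2) + TVar 2 unitSq (⇑(zn n)))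
      atTop (𝓝 ⊤) := by
  obtain ⟨M, hM⟩ := hfb
  let e : Lp ℝ 2 (volume.restrict unitSq) := Lp.const 2 (volume.restrict unitSq) (1 : ℝ)
  have he : 0 < ‖K e‖ := norm_pos_iff.2 (hK1 e (Lp.coeFn_const 2 (volume.restrict unitSq) 1))
  have he1 : ‖e‖ ≤ 1 := by
    simpa [e] using Lp.norm_const_le (p := 2) (μ := volume.restrict unitSq) (c := (1 : ℝ))
  rw [ENNReal.tendsto_nhds_top_iff_nnreal]
  intro R
  set D : ℝ := (√(2 * R) + ‖g‖ + ‖K‖ * (M + 2 * R)) / ‖K e‖ + 2 * R with hD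
  filter_upwards [hz.eventually_gt_atTop D] with n hn
  by_contra! hle
  have hdata : 2⁻¹ * ‖K (fn n + zn n) - g‖ ^ 2 ≤ R :=
    (ENNReal.ofReal_le_coe).1 (le_self_add.trans hle)
  have hTV : TVar 2 unitSq (zn n) ≤ R := le_add_self.trans hle
  have hdata' : ‖K (fn n + zn n) - g‖ ≤ √(2 * R) := Real.le_sqrt_of_sq_le (by linarith)
  obtain ⟨c, hc⟩ := exists_const_eLpNorm_sub_le_TVar (zn n)
  set w : Lp ℝ 2 (volume.restrict unitSq) := zn n - c • e with hw_def
  have hw : ‖w‖ ≤ 2 * R := by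
    have hwae : w =ᵐ[(volume.restrict unitSq)] fun p => zn n p - c := by
      filter_upwards [Lp.coeFn_sub (zn n) (c • e), Lp.coeFn_smul c e,
        Lp.coeFn_const 2 (volume.restrict unitSq) (1 : ℝ)]
        with p h1 h2 h3
      rw [h1, Pi.sub_apply, h2, Pi.smul_apply, h3]
      simp
    rw [Lp.norm_def, eLpNorm_congr_ae hwae]
    refine ENNReal.toReal_le_of_le_ofReal (by positivity) (hc.trans ?_)
    rw [ENNReal.ofReal_mul zero_le_two, ENNReal.ofReal_coe_nnreal, ENNReal.ofReal_ofNat]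
    gcongr
  have hzn : zn n = c • e + w := by rw [hw_def]; abel
  have hcK : |c| * ‖K e‖ ≤ √(2 * R) + ‖g‖ + ‖K‖ * (M + 2 * R) := by
    calc |c| * ‖K e‖ = ‖c • K e‖ := by rw [norm_smul, Real.norm_eq_abs]
      _ = ‖(K (fn n + zn n) - g) + g - K (fn n + w)‖ := by
          rw [hzn]; simp only [map_add, map_smul]; congr 1; abel
      _ ≤ ‖K (fn n + zn n) - g‖ + ‖g‖ + ‖K (fn n + w)‖ :=
          (norm_sub_le _ _).trans (by gcongr; exact norm_add_le _ _)
      _ ≤ √(2 * R) + ‖g‖ + ‖K‖ * (M + 2 * R) := by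
          gcongr
          refine (K.le_opNorm _).trans ?_
          gcongr
          exact (norm_add_le _ _).trans (add_le_add (hM n) hw)
  refine hn.not_ge ?_
  calc ‖zn n‖ ≤ |c| * ‖e‖ + ‖w‖ := by
        rw [hzn]
        refine (norm_add_le _ _).trans ?_
        rw [norm_smul, Real.norm_eq_abs]
    _ ≤ |c| * 1 + 2 * R := by gcongr
    _ ≤ D := by
        rw [hD, mul_one]
        gcongr
        rwa [le_div_iff₀ he]
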